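/- arXiv:0705.0118 — 4 statements merged into one kernel-verified Lean document; each statement's English description precedes it below -/
import Mathlib

section
/- Let φ : R → S be a homomorphism of commutative rings. If the multiplication map μ : S ⊗_R S → S, s ⊗ t ↦ st, is bijective and Tor_i^R(S, S) = 0 for all i ≥ 1, then for every S-module M the action map α_M : S ⊗_R M → M, s ⊗ m ↦ s • m, is bijective and Tor_i^R(S, M) = 0 for all i ≥ 1. -/
/-!
Homological epimorphisms of rings (Geigle–Lenzing).
`φ : R →+* S`; every `S`-module is an `R`-module by restriction of scalars.
-/

universe w u

open CategoryTheory Limits DerivedCategory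

noncomputable section

namespace RingHomEpi

variable {R S : Type u} [CommRing R] [CommRing S] (φ : R →+* S)

instance : (ModuleCat.restrictScalars.{u} φ).Additive where
  map_add := rfl

/-- `S` regarded as an `R`-module via `φ`. -/
abbrev SasR : ModuleCat.{u} R := (ModuleCat.restrictScalars φ).obj (ModuleCat.of S S)

/-- The canonical map `η_M : M → Hom_R(S, M)`, `m ↦ (s ↦ s • m)`. -/
def etaMap (M : ModuleCat.{u} S) :
    M → (SasR φ →ₗ[R] (ModuleCat.restrictScalars φ).obj M) := fun m =>
  { toFun := fun s => (show S from s) • (show M from m)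
    map_add' := fun s t => add_smul (show S from s) (show S from t) (show M from m)
    map_smul' := fun r s => by
      show (φ r • (show S from s)) • (show M from m) =
        φ r • ((show S from s) • (show M from m))
      exact smul_assoc (φ r) (show S from s) (show M from m) }

/-- The action of `S` on an `S`-module `M`, as an `R`-bilinear map. -/
def actionBilin (M : ModuleCat.{u} S) :
    SasR φ →ₗ[R]
      ((ModuleCat.restrictScalars φ).obj M →ₗ[R] (ModuleCat.restrictScalars φ).obj M) where
  toFun s :=
    { toFun := fun m => (show S from s) • (show M from m)
      map_add' := fun m m' => smul_add (show S from s) (show M from m) (show M from m')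
      map_smul' := fun r m => by
        show (show S from s) • (φ r • (show M from m)) =
          φ r • ((show S from s) • (show M from m))
        rw [smul_comm] }
  map_add' s t := LinearMap.ext fun m => add_smul (show S from s) (show S from t) (show M from m)
  map_smul' r s := LinearMap.ext fun m => by
    show (φ r • (show S from s)) • (show M from m) =
      φ r • ((show S from s) • (show M from m))
    exact smul_assoc (φ r) (show S from s) (show M from m)

/-- The action map `α_M : S ⊗_R M → M`, `s ⊗ m ↦ s • m`. -/
def actionMap (M : ModuleCat.{u} S) :
    TensorProduct R (SasR φ) ((ModuleCat.restrictScalars φ).obj M) →ₗ[R]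
      (ModuleCat.restrictScalars φ).obj M :=
  TensorProduct.lift (actionBilin φ M)

/-- The multiplication map `μ : S ⊗_R S → S`, `s ⊗ t ↦ s * t`. -/
def mulMap : TensorProduct R (SasR φ) (SasR φ) →ₗ[R] SasR φ :=
  actionMap φ (ModuleCat.of S S)


open CategoryTheory.Abelian TensorProduct

/-- Duality lemma. -/
theorem exact_rTensor_iff {R : Type u} [CommRing R] {A X Y Z : Type u} [AddCommGroup A]
    [AddCommGroup X] [AddCommGroup Y] [AddCommGroup Z] [Module R A] [Module R X] [Module R Y]
    [Module R Z] (d2 : X →ₗ[R] Y) (d1 : Y →ₗ[R] Z) (h : d1 ∘ₗ d2 = 0) :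
    Function.Exact (d2.rTensor A) (d1.rTensor A) ↔
      ∀ f : Y →ₗ[R] CharacterModule A, f ∘ₗ d2 = 0 →
        ∃ g : Z →ₗ[R] CharacterModule A, g ∘ₗ d1 = f := by
  constructor
  · intro hex f hf
    let c : CharacterModule (Y ⊗[R] A) := CharacterModule.homEquiv f
    have hc : ∀ x, d1.rTensor A x = 0 → c x = 0 := by
      intro x hx
      obtain ⟨y, rfl⟩ := (hex x).1 hx
      induction y using TensorProduct.induction_on with
      | zero => simp
      | tmul a b =>
        have : f (d2 a) = 0 := congr($hf a)
        change f (d2 a) b = 0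
        rw [this]; rfl
      | add a b ha hb =>
        rw [map_add, map_add, ha (hex.apply_apply_eq_zero _), hb (hex.apply_apply_eq_zero _),
          add_zero]
    let q := d1.rTensor A
    let c1 : (Y ⊗[R] A ⧸ LinearMap.ker q) →+ AddCircle (1 : ℚ) :=
      QuotientAddGroup.lift (LinearMap.ker q).toAddSubgroup c (fun x hx => hc x hx)
    let i : (Y ⊗[R] A ⧸ LinearMap.ker q) →ₗ[R] (Z ⊗[R] A) := (LinearMap.ker q).liftQ q le_rfl
    have hi : Function.Injective i := by
      rw [← LinearMap.ker_eq_bot]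
      exact Submodule.ker_liftQ_eq_bot _ _ _ le_rfl
    obtain ⟨c2, hc2⟩ := CharacterModule.dual_surjective_of_injective i hi c1
    refine ⟨CharacterModule.homEquiv.symm c2, ?_⟩
    ext y a
    exact DFunLike.congr_fun hc2 (Submodule.Quotient.mk (y ⊗ₜ a))
  · intro H x
    constructor
    · intro hx
      change x ∈ LinearMap.range (d2.rTensor A)
      rw [← Submodule.Quotient.mk_eq_zero]
      refine CharacterModule.eq_zero_of_character_apply fun c => ?_
      let c' : CharacterModule (Y ⊗[R] A) :=
        CharacterModule.dual (LinearMap.range (d2.rTensor A)).mkQ c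
      obtain ⟨g, hg⟩ := H (CharacterModule.homEquiv.symm c') (by
        ext z a
        change c (Submodule.Quotient.mk (d2.rTensor A (z ⊗ₜ a))) = 0
        have h0 : (Submodule.Quotient.mk (d2.rTensor A (z ⊗ₜ a)) :
            (Y ⊗[R] A) ⧸ LinearMap.range (d2.rTensor A)) = 0 :=
          (Submodule.Quotient.mk_eq_zero _).2 (LinearMap.mem_range_self _ _)
        rw [h0, map_zero])
      have h2 : CharacterModule.dual (d1.rTensor A) (CharacterModule.homEquiv g) = c' := by
        apply CharacterModule.homEquiv.symm.injective
        rw [← hg]; rfl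
      have h3 := DFunLike.congr_fun h2 x
      change CharacterModule.homEquiv g (d1.rTensor A x) = c (Submodule.Quotient.mk x) at h3
      rw [← h3, hx, map_zero]
    · rintro ⟨y, rfl⟩
      rw [← LinearMap.comp_apply, ← LinearMap.rTensor_comp, h]
      simp

theorem exact_lTensor_iff_rTensor {R : Type u} [CommRing R] {A X Y Z : Type u} [AddCommGroup A]
    [AddCommGroup X] [AddCommGroup Y] [AddCommGroup Z] [Module R A] [Module R X] [Module R Y]
    [Module R Z] (d2 : X →ₗ[R] Y) (d1 : Y →ₗ[R] Z) :
    Function.Exact (d2.lTensor A) (d1.lTensor A) ↔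
    Function.Exact (d2.rTensor A) (d1.rTensor A) := by
  refine (Function.Exact.iff_of_ladder_linearEquiv (e₁ := TensorProduct.comm R A X)
    (e₂ := TensorProduct.comm R A Y) (e₃ := TensorProduct.comm R A Z) ?_ ?_).symm
  · ext; simp
  · ext; simp

theorem tor_isZero_iff {R : Type u} [CommRing R] (A X : ModuleCat.{u} R) (n : ℕ) :
    IsZero (((Tor (ModuleCat.{u} R) (n + 1)).obj A).obj X) ↔
      ∀ x : Ext X (ModuleCat.of R (CharacterModule A)) (n + 1), x = 0 := by
  let P := projectiveResolution X
  have e := P.isoLeftDerivedObj ((MonoidalCategory.tensoringLeft (ModuleCat.{u} R)).obj A) (n + 1)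
  refine (Iso.isZero_iff e).trans ?_
  refine (HomologicalComplex.exactAt_iff_isZero_homology _ _).symm.trans ?_
  rw [HomologicalComplex.exactAt_iff' _ (n + 2) (n + 1) n (by simp) (by simp)]
  rw [ShortComplex.ShortExact.moduleCat_exact_iff_function_exact]
  have hd : (P.complex.d (n + 1) n).hom ∘ₗ (P.complex.d (n + 2) (n + 1)).hom = 0 := by
    rw [← ModuleCat.hom_comp, P.complex.d_comp_d]; rfl
  refine (exact_lTensor_iff_rTensor (A := A) (P.complex.d (n + 2) (n + 1)).hom
    (P.complex.d (n + 1) n).hom).trans ?_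
  rw [exact_rTensor_iff _ _ hd]
  constructor
  · intro H x
    obtain ⟨f, hf, rfl⟩ := P.extMk_surjective x (n + 2) rfl
    rw [P.extMk_eq_zero_iff f (n + 2) rfl hf n rfl]
    obtain ⟨g, hg⟩ := H f.hom (by rw [← ModuleCat.hom_comp, hf]; rfl)
    exact ⟨ModuleCat.ofHom g, ModuleCat.hom_ext hg⟩
  · intro H f hf
    have := H (P.extMk (ModuleCat.ofHom f) (n + 2) rfl (ModuleCat.hom_ext hf))
    rw [P.extMk_eq_zero_iff _ (n + 2) rfl _ n rfl] at this
    obtain ⟨g, hg⟩ := this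
    exact ⟨g.hom, congr(($hg).hom)⟩

/-- Ext vanishing passes to direct sums. -/
theorem ext_finsupp {R : Type u} [CommRing R] (N X Y : ModuleCat.{u} R) (n : ℕ)
    {ι : Type u} (j : ι → (Y ⟶ X))
    (hdesc : ∀ (Z : ModuleCat.{u} R) (g : ι → (Y ⟶ Z)), ∃ h : X ⟶ Z, ∀ i, j i ≫ h = g i)
    (hext : ∀ (Z : ModuleCat.{u} R) (a b : X ⟶ Z), (∀ i, j i ≫ a = j i ≫ b) → a = b)
    (H : ∀ x : Ext Y N (n + 1), x = 0) : ∀ x : Ext X N (n + 1), x = 0 := by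
  intro x
  let I := injectiveResolution N
  obtain ⟨f, hf, rfl⟩ := I.extMk_surjective x (n + 2) rfl
  rw [I.extMk_eq_zero_iff f (n + 2) rfl hf n rfl]
  have h1 : ∀ i, ∃ g : Y ⟶ I.cocomplex.X n, g ≫ I.cocomplex.d n (n + 1) = j i ≫ f := by
    intro i
    rw [← I.extMk_eq_zero_iff (j i ≫ f) (n + 2) rfl (by simp [hf]) n rfl]
    exact H _
  choose g hg using h1
  obtain ⟨h, hh⟩ := hdesc _ g
  refine ⟨h, hext _ _ _ fun i => ?_⟩
  rw [← Category.assoc, hh, hg]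

theorem actionMap_tmul (M : ModuleCat.{u} S) (s : SasR φ)
    (m : (ModuleCat.restrictScalars φ).obj M) :
    actionMap φ M (s ⊗ₜ[R] m) = (show M from (show S from s) • (show M from m)) := rfl

theorem actionMap_bijective (hμ : Function.Bijective (mulMap φ)) (M : ModuleCat.{u} S) :
    Function.Bijective (actionMap φ M) := by
  have key : ∀ (s : SasR φ) (m : (ModuleCat.restrictScalars φ).obj M),
      s ⊗ₜ[R] m = (show SasR φ from (1 : S)) ⊗ₜ[R]
        (show (ModuleCat.restrictScalars φ).obj M from
          (show M from (show S from s) • (show M from m))) := by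
    intro s m
    have h1 : s ⊗ₜ[R] (show SasR φ from (1 : S)) = (show SasR φ from (1 : S)) ⊗ₜ[R] s := by
      apply hμ.1
      change (show S from s) * 1 = 1 * (show S from s)
      rw [mul_one, one_mul]
    have h2 := congrArg (LinearMap.lTensor (SasR φ) ((actionBilin φ M).flip m)) h1
    rw [LinearMap.lTensor_tmul, LinearMap.lTensor_tmul] at h2
    refine Eq.trans ?_ h2
    congr 1
    exact (one_smul S (show M from m)).symm
  constructor
  · rw [injective_iff_map_eq_zero]
    intro x hx
    have h3 : ∀ x : TensorProduct R (SasR φ) ((ModuleCat.restrictScalars φ).obj M),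
        x = (show SasR φ from (1 : S)) ⊗ₜ[R] actionMap φ M x := by
      intro x
      induction x using TensorProduct.induction_on with
      | zero => rw [map_zero, TensorProduct.tmul_zero]
      | tmul a b => exact key a b
      | add a b ha hb => rw [map_add, TensorProduct.tmul_add, ← ha, ← hb]
    rw [h3 x, hx, TensorProduct.tmul_zero]
  · intro m
    exact ⟨(show SasR φ from (1 : S)) ⊗ₜ[R] m, one_smul S (show M from m)⟩

theorem lTensor_injective (hμ : Function.Bijective (mulMap φ)) {M N : ModuleCat.{u} S}
    (f : M ⟶ N) (hf : Function.Injective f) :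
    Function.Injective
      (LinearMap.rTensor (SasR φ) ((ModuleCat.restrictScalars φ).map f).hom) := by
  rw [← LinearMap.lTensor_inj_iff_rTensor_inj]
  have hc : ∀ x, actionMap φ N
      (LinearMap.lTensor (SasR φ) ((ModuleCat.restrictScalars φ).map f).hom x) =
      ((ModuleCat.restrictScalars φ).map f).hom (actionMap φ M x) := by
    intro x
    induction x using TensorProduct.induction_on with
    | zero => simp only [map_zero]
    | tmul a b => exact (f.hom.map_smul (show S from a) (show M from b)).symm
    | add a b ha hb => simp only [map_add, ha, hb]
  intro x y hxy
  apply (actionMap_bijective φ hμ M).1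
  apply hf
  change ((ModuleCat.restrictScalars φ).map f).hom _ =
    ((ModuleCat.restrictScalars φ).map f).hom _
  rw [← hc, ← hc, hxy]

theorem ext_free (N : ModuleCat.{u} R) (n : ℕ) (ι : Type u)
    (H : ∀ x : Ext (SasR φ) N (n + 1), x = 0) :
    ∀ x : Ext ((ModuleCat.restrictScalars φ).obj (ModuleCat.of S (ι →₀ S))) N (n + 1),
      x = 0 := by
  refine ext_finsupp N _ (SasR φ) n (ι := ι)
    (fun i => (ModuleCat.restrictScalars φ).map (ModuleCat.ofHom (Finsupp.lsingle i))) ?_ ?_ H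
  · intro Z g
    let h0 : (ι →₀ S) →+ Z := Finsupp.liftAddHom (fun i => (g i).hom.toAddMonoidHom)
    have h0s : ∀ i s, h0 (Finsupp.single i s) = (g i).hom s := fun i s =>
      Finsupp.liftAddHom_apply_single (fun i => (g i).hom.toAddMonoidHom) i s
    refine ⟨ModuleCat.ofHom (X := (ModuleCat.restrictScalars φ).obj (ModuleCat.of S (ι →₀ S)))
      (Y := Z) { toFun := h0, map_add' := h0.map_add, map_smul' := ?_ }, ?_⟩
    · intro r x
      change h0 (φ r • (show ι →₀ S from x)) = r • h0 x
      have : ∀ x : ι →₀ S, h0 (φ r • x) = r • h0 x := by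
        intro x
        induction x using Finsupp.induction_linear with
        | zero => simp
        | add a b ha hb => rw [smul_add, map_add, map_add, smul_add, ha, hb]
        | single i s =>
          rw [Finsupp.smul_single, h0s, h0s]
          exact (g i).hom.map_smul r s
      exact this x
    · intro i
      ext s
      exact h0s i s
  · intro Z a b hab
    ext x
    have : ∀ x : ι →₀ S, a.hom x = b.hom x := by
      intro x
      induction x using Finsupp.induction_linear with
      | zero => exact a.hom.map_zero.trans b.hom.map_zero.symm
      | add x y hx hy =>
        exact (a.hom.map_add x y).trans ((congrArg₂ _ hx hy).trans (b.hom.map_add x y).symm)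
      | single i s => exact congr(($(hab i)).hom s)
    exact this x

theorem exists_shortExact (M : ModuleCat.{u} S) :
    ∃ (ι : Type u) (K : ModuleCat.{u} S) (f : K ⟶ ModuleCat.of S (ι →₀ S))
      (g : ModuleCat.of S (ι →₀ S) ⟶ M) (w : f ≫ g = 0),
      (ShortComplex.mk f g w).ShortExact ∧ Function.Injective f := by
  let g : ModuleCat.of S (M →₀ S) ⟶ M := ModuleCat.ofHom (Finsupp.linearCombination S id)
  have hg : Function.Surjective g := Finsupp.linearCombination_id_surjective S M
  have : Epi g := (ModuleCat.epi_iff_surjective g).2 hg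
  refine ⟨M, kernel g, kernel.ι g, g, kernel.condition g, ?_,
    (ModuleCat.mono_iff_injective _).1 inferInstance⟩
  exact { exact := ShortComplex.exact_kernel g
          mono_f := inferInstanceAs (Mono (kernel.ι g))
          epi_g := this }

theorem extClass_comp_eq_zero {R : Type u} [CommRing R] {D : ShortComplex (ModuleCat.{u} R)}
    (hD : D.ShortExact) (N : ModuleCat.{u} R) (h : D.X₁ ⟶ N) (h' : D.X₂ ⟶ N)
    (e : h = D.f ≫ h') : hD.extClass.comp (Ext.mk₀ h) (add_zero 1) = 0 := by
  rw [e, ← Ext.mk₀_comp_mk₀]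
  exact hD.extClass_comp_assoc _

theorem ext_vanish (hμ : Function.Bijective (mulMap φ))
    (H : ∀ n, ∀ x : Ext (SasR φ) (ModuleCat.of R (CharacterModule (SasR φ))) (n + 1), x = 0)
    (n : ℕ) : ∀ (M : ModuleCat.{u} S)
      (x : Ext ((ModuleCat.restrictScalars φ).obj M)
        (ModuleCat.of R (CharacterModule (SasR φ))) (n + 1)), x = 0 := by
  induction n with
  | zero =>
    intro M x
    obtain ⟨ι, K, f, g, w, hC, hf⟩ := exists_shortExact M
    have hD := hC.map_of_exact (ModuleCat.restrictScalars φ)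
    obtain ⟨y, hy⟩ := Ext.contravariant_sequence_exact₃ hD _ x
      (ext_free φ _ _ _ (H 0) _) (n₀ := 0) rfl
    obtain ⟨h, rfl⟩ := (Ext.mk₀_bijective _ _).2 y
    have hinj := lTensor_injective φ hμ f hf
    rw [rTensor_injective_iff_lcomp_surjective] at hinj
    obtain ⟨h', hh'⟩ := hinj h.hom
    rw [← hy]
    exact extClass_comp_eq_zero hD _ h (ModuleCat.ofHom
      (X := (ModuleCat.restrictScalars φ).obj (ModuleCat.of S (ι →₀ S))) h')
      (ModuleCat.hom_ext hh'.symm)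
  | succ n ih =>
    intro M x
    obtain ⟨ι, K, f, g, w, hC, hf⟩ := exists_shortExact M
    have hD := hC.map_of_exact (ModuleCat.restrictScalars φ)
    obtain ⟨y, hy⟩ := Ext.contravariant_sequence_exact₃ hD _ x
      (ext_free φ _ _ _ (H (n + 1)) _) (n₀ := n + 1) (by omega)
    have hy0 : y = 0 := ih K y
    rw [← hy, hy0, Ext.comp_zero]
    rfl

/-- If `μ : S ⊗_R S → S` is bijective and `Tor_i^R(S,S) = 0` for `i ≥ 1`, then for every
`S`-module `M` the action map `α_M : S ⊗_R M → M` is bijective and `Tor_i^R(S,M) = 0`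
for `i ≥ 1`. -/
theorem action_bijective_and_tor_vanishing_of_mul_bijective_and_tor_vanishing
    (hμ : Function.Bijective (mulMap φ))
    (htor : ∀ i : ℕ, 1 ≤ i →
      IsZero (((Tor (ModuleCat.{u} R) i).obj (SasR φ)).obj (SasR φ))) :
    ∀ M : ModuleCat.{u} S, Function.Bijective (actionMap φ M) ∧
      ∀ i : ℕ, 1 ≤ i →
        IsZero (((Tor (ModuleCat.{u} R) i).obj (SasR φ)).obj
          ((ModuleCat.restrictScalars φ).obj M)) := by
  intro M
  refine ⟨actionMap_bijective φ hμ M, fun i hi => ?_⟩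
  obtain ⟨n, rfl⟩ : ∃ n, i = n + 1 := ⟨i - 1, by omega⟩
  rw [tor_isZero_iff]
  refine ext_vanish φ hμ (fun n => ?_) n M
  rw [← tor_isZero_iff]
  exact htor (n + 1) (by omega)

end RingHomEpi
end
end

section
/- Let φ : R → S be a homomorphism of commutative rings. If for every S-module M the action map α_M : S ⊗_R M → M, s ⊗ m ↦ s • m, is bijective and Tor_i^R(S, M) = 0 for all i ≥ 1, then for every S-module M the canonical map η_M : M → Hom_R(S, M), m ↦ (s ↦ s • m), is bijective and Ext^i_R(S, M) = 0 for all i ≥ 1. -/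
/-!
Homological epimorphisms of rings (Geigle–Lenzing).
`φ : R →+* S`; every `S`-module is an `R`-module by restriction of scalars.
-/

universe w u

open CategoryTheory Limits DerivedCategory

noncomputable section

namespace RingHomEpi

variable {R S : Type u} [CommRing R] [CommRing S] (φ : R →+* S)

theorem split_core {S : Type*} [CommRing S] (Q : ℕ → Type*) [∀ n, AddCommGroup (Q n)] [∀ n, Module S (Q n)]
   [∀ n, Module.Projective S (Q n)] (d : ∀ n, Q (n+1) →ₗ[S] Q n)
   (hd : ∀ n, Function.Exact (d (n+1)) (d n)) (A : Type*) [AddCommGroup A] [Module S A] [Module.Projective S A]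
   (e : Q 0 →ₗ[S] A) (he : Function.Surjective e) (hde : Function.Exact (d 0) e) (n : ℕ) :
   ∃ s : Q n →ₗ[S] Q (n+1), d n ∘ₗ s ∘ₗ d n = d n := by
  induction n with
  | zero => 
    obtain ⟨t, ht⟩ := Module.projective_lifting_property e LinearMap.id he
    have key : ∀ x, e (x - t (e x)) = 0 := fun x => by
      have := LinearMap.congr_fun ht (e x)
      simp at this
      simp [this]
    let p : Q 0 →ₗ[S] LinearMap.range (d 0) := LinearMap.codRestrict _ (LinearMap.id - t ∘ₗ e) 
      (fun x => (hde _).1 (key x))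
    have hp : ∀ x, (p x : Q 0) = x - t (e x) := fun x => rfl
    obtain ⟨s, hs⟩ := Module.projective_lifting_property (d 0).rangeRestrict p (d 0).surjective_rangeRestrict
    refine ⟨s, LinearMap.ext fun x => ?_⟩
    have := congrArg Subtype.val (LinearMap.congr_fun hs (d 0 x))
    simpa [hp, hde.apply_apply_eq_zero] using this
  | succ n ih =>
    obtain ⟨t, ht⟩ := ih
    have key : ∀ x, d n (x - t (d n x)) = 0 := fun x => by
      have := LinearMap.congr_fun ht x
      simp at this
      simp [this]
    let p : Q (n+1) →ₗ[S] LinearMap.range (d (n+1)) := LinearMap.codRestrict _ (LinearMap.id - t ∘ₗ d n) 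
      (fun x => (hd n _).1 (key x))
    have hp : ∀ x, (p x : Q (n+1)) = x - t (d n x) := fun x => rfl
    obtain ⟨s, hs⟩ := Module.projective_lifting_property (d (n+1)).rangeRestrict p (d (n+1)).surjective_rangeRestrict
    refine ⟨s, LinearMap.ext fun x => ?_⟩
    have := congrArg Subtype.val (LinearMap.congr_fun hs (d (n+1) x))
    simpa [hp, (hd n).apply_apply_eq_zero] using this

open TensorProduct in
theorem core {R S : Type*} [CommRing R] [CommRing S] [Algebra R S] (P : ℕ → Type*) [∀ n, AddCommGroup (P n)]
   [∀ n, Module R (P n)]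
   [∀ n, Module.Projective R (P n)] (d : ∀ n, P (n+1) →ₗ[R] P n)
   (hd : ∀ n, Function.Exact ((d (n+1)).lTensor S) ((d n).lTensor S)) 
   (π : P 0 →ₗ[R] S) (hπ : Function.Surjective π) (hdπ : Function.Exact (d 0) π)
   (hS : Function.Injective (LinearMap.mul' R S))
   (N : Type*) [AddCommGroup N] [Module R N] [Module S N] [IsScalarTower R S N] (n : ℕ)
   (f : P (n+1) →ₗ[R] N) (hf : f ∘ₗ d (n+1) = 0) : ∃ g : P n →ₗ[R] N, g ∘ₗ d n = f := by
  have he : ∀ x, LinearMap.liftBaseChange S π x = LinearMap.mul' R S (π.lTensor S x) := fun x => by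
    induction x with
    | zero => simp
    | add x y hx hy => simp only [map_add, hx, hy]
    | tmul x y => simp
  obtain ⟨s, hs⟩ := split_core (fun n => TensorProduct R S (P n)) (fun n => (d n).baseChange S) (fun n => hd n) S
    (LinearMap.liftBaseChange S π) (fun x => by
      obtain ⟨y, hy⟩ := hπ 1
      exact ⟨x ⊗ₜ[R] y, by simp [hy]⟩) (fun x => by
        rw [he, map_eq_zero_iff _ hS]
        exact lTensor_exact S hdπ hπ x) n
  obtain ⟨s', hs'⟩ : ∃ s' : TensorProduct R S (P n) →ₗ[S] TensorProduct R S (P (n+1)), s' = s := ⟨s, rfl⟩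
  refine ⟨(LinearMap.liftBaseChange S f ∘ₗ s').restrictScalars R ∘ₗ TensorProduct.mk R S (P n) 1, ?_⟩
  ext x
  have hz : ∀ y, (d n).lTensor S y = 0 → LinearMap.liftBaseChange S f y = 0 := fun y hy => by
    obtain ⟨z, rfl⟩ := (hd n y).1 hy
    clear hy
    induction z with
    | zero => simp
    | add x y hx hy => simp only [map_add, hx, hy, add_zero]
    | tmul a b => 
      have := LinearMap.congr_fun hf b
      simp at this
      simp [this]
  have h2 := hz (s' (1 ⊗ₜ[R] d n x) - 1 ⊗ₜ[R] x) (by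
    have := LinearMap.congr_fun hs (1 ⊗ₜ[R] x)
    rw [map_sub, sub_eq_zero, hs']
    exact this)
  rw [map_sub, sub_eq_zero] at h2
  simpa using h2

open TensorProduct in
theorem eta_surj (M : ModuleCat.{u} S)
    (h : Function.Bijective (actionMap φ (ModuleCat.of S S))) :
    Function.Bijective (etaMap φ M) := by
  constructor
  · intro m m' hm
    have := LinearMap.congr_fun hm (1 : S)
    change (1 : S) • m = (1 : S) • m' at this
    simpa using this
  · intro f
    refine ⟨f (1 : S), LinearMap.ext fun s => ?_⟩
    have h1 : (TensorProduct.tmul R s (show SasR φ from (1 : S))) =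
        TensorProduct.tmul R (show SasR φ from (1 : S)) s := by
      apply h.1
      change (show S from s) * (1 : S) = (1 : S) * (show S from s)
      rw [mul_comm]
    have h2 := congrArg (fun z => actionMap φ M (f.lTensor (SasR φ) z)) h1
    change (show S from s) • (show M from f (1 : S)) = (1 : S) • (show M from f s) at h2
    rw [one_smul] at h2
    exact h2

theorem tor_exact {X Y : ModuleCat.{u} R} (P : ProjectiveResolution Y)
    (h : ∀ i : ℕ, 1 ≤ i → IsZero (((Tor (ModuleCat.{u} R) i).obj X).obj Y)) (n : ℕ) :
    Function.Exact ((P.complex.d (n+2) (n+1)).hom.lTensor X)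
      ((P.complex.d (n+1) n).hom.lTensor X) := by
  have h1 := (h (n+1) (by omega)).of_iso
    (P.isoLeftDerivedObj ((MonoidalCategory.tensoringLeft (ModuleCat.{u} R)).obj X) (n+1)).symm
  have h2 := (HomologicalComplex.exactAt_iff_isZero_homology _ _).2 h1
  rw [HomologicalComplex.exactAt_iff' _ (n + 2) (n + 1) n (by simp) (by simp),
    ShortComplex.ShortExact.moduleCat_exact_iff_function_exact] at h2
  exact h2

theorem ext_core (P : ProjectiveResolution (SasR φ)) (M : ModuleCat.{u} S)
    (hS : Function.Bijective (actionMap φ (ModuleCat.of S S)))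
    (hd : ∀ n, Function.Exact ((P.complex.d (n+2) (n+1)).hom.lTensor (SasR φ))
      ((P.complex.d (n+1) n).hom.lTensor (SasR φ))) (n : ℕ)
    (f : P.complex.X (n+1) ⟶ (ModuleCat.restrictScalars φ).obj M)
    (hf : P.complex.d (n+2) (n+1) ≫ f = 0) :
    ∃ g : P.complex.X n ⟶ (ModuleCat.restrictScalars φ).obj M,
      P.complex.d (n+1) n ≫ g = f := by
  let : Algebra R S := φ.toAlgebra
  let : Module R M := Module.compHom M φ
  have : IsScalarTower R S M := ⟨fun r s m => mul_smul (φ r) s m⟩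
  have : ∀ n, Module.Projective R (P.complex.X n) := fun n =>
    (IsProjective.iff_projective _).2 (P.projective n)
  have hπ : Function.Surjective (P.π.f 0).hom :=
    (ModuleCat.epi_iff_surjective (P.π.f 0)).1 inferInstance
  have hdπ := (ShortComplex.ShortExact.moduleCat_exact_iff_function_exact _).1 P.exact₀
  have hm : Function.Injective (LinearMap.mul' R S) := hS.1
  let f' : P.complex.X (n+1) →ₗ[R] M := f.hom
  have hf' : f' ∘ₗ (P.complex.d (n+2) (n+1)).hom = 0 := congrArg ModuleCat.Hom.hom hf
  obtain ⟨g, hg⟩ := core (R := R) (S := S) (fun n => P.complex.X n)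
    (fun n => (P.complex.d (n+1) n).hom) hd (P.π.f 0).hom hπ hdπ hm M n f' hf'
  exact ⟨ModuleCat.ofHom (Y := (ModuleCat.restrictScalars φ).obj M) g, ModuleCat.hom_ext hg⟩


variable [CategoryTheory.HasExt.{w} (ModuleCat.{u} R)]

/-- If for every `S`-module `M` the action map `α_M : S ⊗_R M → M` is bijective and
`Tor_i^R(S,M) = 0` for `i ≥ 1`, then for every `S`-module `M` the canonical map
`η_M : M → Hom_R(S,M)` is bijective and `Ext^i_R(S,M) = 0` for `i ≥ 1`. -/
theorem eta_bijective_and_ext_vanishing_of_action_bijective_and_tor_vanishing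
    (h : ∀ M : ModuleCat.{u} S, Function.Bijective (actionMap φ M) ∧
      ∀ i : ℕ, 1 ≤ i →
        IsZero (((Tor (ModuleCat.{u} R) i).obj (SasR φ)).obj
          ((ModuleCat.restrictScalars φ).obj M))) :
    ∀ M : ModuleCat.{u} S, Function.Bijective (etaMap φ M) ∧
      ∀ i : ℕ, 1 ≤ i →
        Subsingleton (Abelian.Ext (SasR φ) ((ModuleCat.restrictScalars φ).obj M) i) := by
  intro M
  have hS := h (ModuleCat.of S S)
  refine ⟨eta_surj φ M hS.1, fun i hi => ?_⟩
  obtain ⟨n, rfl⟩ : ∃ n, i = n + 1 := ⟨i - 1, by omega⟩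
  let P := projectiveResolution (SasR φ)
  have key : ∀ α : Abelian.Ext (SasR φ) ((ModuleCat.restrictScalars φ).obj M) (n+1), α = 0 := by
    intro α
    obtain ⟨f, hf, rfl⟩ := P.extMk_surjective α (n+2) rfl
    rw [P.extMk_eq_zero_iff f (n+2) rfl hf n rfl]
    exact ext_core φ P M hS.1 (tor_exact P hS.2) n f hf
  exact ⟨fun a b => (key a).trans (key b).symm⟩

end RingHomEpi
end
end

section
/- Let φ : R → S be a homomorphism of commutative rings. If for every S-module M the canonical map η_M : M → Hom_R(S, M), m ↦ (s ↦ s • m), is bijective and Ext^i_R(S, M) = 0 for all i ≥ 1, then for every S-module M the action map α_M : S ⊗_R M → M, s ⊗ m ↦ s • m, is bijective and Tor_i^R(S, M) = 0 for all i ≥ 1. -/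
/-!
Homological epimorphisms of rings (Geigle–Lenzing).
`φ : R →+* S`; every `S`-module is an `R`-module by restriction of scalars.
-/

universe w u

open CategoryTheory Limits DerivedCategory

noncomputable section

namespace RingHomEpi

variable {R S : Type u} [CommRing R] [CommRing S] (φ : R →+* S)

open Abelian in
/-- All higher `Ext` groups from `X` to the character module of `N` vanish. -/
def ExtGood {R : Type u} [CommRing R] [CategoryTheory.HasExt.{w} (ModuleCat.{u} R)]
    (X : ModuleCat.{u} R) (N : Type u) [AddCommGroup N] [Module R N] : Prop :=
  ∀ i : ℕ, Subsingleton (Abelian.Ext.{w} X (ModuleCat.of R (CharacterModule N)) (i + 1))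

section aux

variable {R : Type u} [CommRing R]

theorem extSubsingleton_of_iso [CategoryTheory.HasExt.{w} (ModuleCat.{u} R)]
    {X A B : ModuleCat.{u} R} (e : A ≅ B) (i : ℕ)
    (h : Subsingleton (Abelian.Ext.{w} X A i)) : Subsingleton (Abelian.Ext.{w} X B i) := by
  refine ⟨fun a b => ?_⟩
  have key : ∀ c : Abelian.Ext.{w} X B i,
      c = (c.comp (Abelian.Ext.mk₀ e.inv) (add_zero i)).comp
        (Abelian.Ext.mk₀ e.hom) (add_zero i) := by
    intro c
    rw [Abelian.Ext.comp_assoc_of_third_deg_zero, Abelian.Ext.mk₀_comp_mk₀]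
    simp
  rw [key a, key b, Subsingleton.elim (a.comp (Abelian.Ext.mk₀ e.inv) (add_zero i))]

theorem ExtGood.of_equiv [CategoryTheory.HasExt.{w} (ModuleCat.{u} R)]
    {X : ModuleCat.{u} R} {N N' : Type u} [AddCommGroup N]
    [Module R N] [AddCommGroup N'] [Module R N'] (e : N ≃ₗ[R] N') (h : ExtGood.{w} X N) :
    ExtGood.{w} X N' := fun i =>
  extSubsingleton_of_iso (CharacterModule.congr e).toModuleIso (i + 1) (h i)

theorem dual_exact {A B C : Type u} [AddCommGroup A] [AddCommGroup B] [AddCommGroup C]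
    [Module R A] [Module R B] [Module R C] (f : A →ₗ[R] B) (g : B →ₗ[R] C)
    (hfg : Function.Exact f g) (hg : Function.Surjective g) :
    Function.Exact (CharacterModule.dual g) (CharacterModule.dual f) := by
  intro c
  constructor
  · intro hc
    have hle : LinearMap.ker g.toAddMonoidHom.toIntLinearMap ≤
        LinearMap.ker (AddMonoidHom.toIntLinearMap (show B →+ AddCircle (1 : ℚ) from c)) := by
      intro b hb
      obtain ⟨a, rfl⟩ := (hfg b).1 hb
      exact DFunLike.congr_fun hc a
    choose s hs using hg
    have hz : ∀ b : B, g b = 0 → c b = 0 := fun b hb => hle hb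
    have hd : ∀ b b' : B, g b = g b' → c b = c b' := fun b b' hb => by
      have := hz (b - b') (by rw [map_sub, hb, sub_self])
      rwa [map_sub, sub_eq_zero] at this
    let c' : C →+ AddCircle (1 : ℚ) :=
      { toFun := fun x => c (s x)
        map_zero' := hz _ (hs 0)
        map_add' := fun x y => by
          rw [← map_add]
          exact hd _ _ (by rw [map_add, hs, hs, hs]) }
    exact ⟨c', CharacterModule.ext _ fun b => hd _ _ (hs _)⟩
  · rintro ⟨c', rfl⟩
    refine CharacterModule.ext _ fun a => ?_
    show c' (g (f a)) = 0
    rw [hfg.apply_apply_eq_zero, map_zero]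

theorem ExtGood.ker_aux [CategoryTheory.HasExt.{w} (ModuleCat.{u} R)]
    {X : ModuleCat.{u} R} {K F N : Type u} [AddCommGroup K] [Module R K]
    [AddCommGroup F] [Module R F] [AddCommGroup N] [Module R N] [Module.Flat R F]
    (f : K →ₗ[R] F) (g : F →ₗ[R] N) (hf : Function.Injective f) (hfg : Function.Exact f g)
    (hg : Function.Surjective g) (h : ExtGood.{w} X N) :
    ExtGood.{w} X K ∧ Function.Injective (f.lTensor X) := by
  let T : ShortComplex (ModuleCat.{u} R) := ShortComplex.mk
    (ModuleCat.ofHom (CharacterModule.dual g)) (ModuleCat.ofHom (CharacterModule.dual f))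
    (by
      refine ModuleCat.hom_ext (LinearMap.ext fun c => ?_)
      exact (dual_exact f g hfg hg).apply_apply_eq_zero c)
  have hT : T.ShortExact :=
    { exact := (ShortComplex.ShortExact.moduleCat_exact_iff_function_exact _).mpr
        (dual_exact f g hfg hg)
      mono_f := (ModuleCat.mono_iff_injective _).2
        (CharacterModule.dual_injective_of_surjective g hg)
      epi_g := (ModuleCat.epi_iff_surjective _).2
        (CharacterModule.dual_surjective_of_injective f hf) }
  have : Module.Injective R (CharacterModule F) :=
    Module.Flat.iff_characterModule_injective.1 inferInstance
  have : Injective T.X₂ := Module.injective_object_of_injective_module R (CharacterModule F)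
  constructor
  · intro i
    refine ⟨fun a b => ?_⟩
    have key : ∀ c : Abelian.Ext.{w} X T.X₃ (i + 1), c = 0 := by
      intro c
      obtain ⟨x₂, rfl⟩ := Abelian.Ext.covariant_sequence_exact₃ X hT c rfl
        (@Subsingleton.elim _ (h (i + 1)) _ _)
      rw [Abelian.Ext.eq_zero_of_injective x₂, Abelian.Ext.zero_comp]
    rw [key a, key b]
  · rw [← CharacterModule.dual_surjective_iff_injective]
    intro c
    obtain ⟨x₂, hx₂⟩ := Abelian.Ext.covariant_sequence_exact₃ X hT
      (Abelian.Ext.mk₀ (ModuleCat.ofHom (CharacterModule.curry c) : X ⟶ T.X₃)) rfl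
        (@Subsingleton.elim _ (h 0) _ _)
    obtain ⟨y, rfl⟩ := (Abelian.Ext.mk₀_bijective X T.X₂).2 x₂
    rw [Abelian.Ext.mk₀_comp_mk₀] at hx₂
    have hy := (Abelian.Ext.mk₀_bijective X T.X₃).1 hx₂
    refine ⟨CharacterModule.uncurry (R := R) y.hom, ?_⟩
    apply (CharacterModule.homEquiv (R := R)).symm.injective
    refine LinearMap.ext fun x => CharacterModule.ext _ fun k => ?_
    have h1 := DFunLike.congr_fun (DFunLike.congr_fun (congrArg ModuleCat.Hom.hom hy) x) k
    exact h1

theorem ExtGood.ker [CategoryTheory.HasExt.{w} (ModuleCat.{u} R)]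
    {X : ModuleCat.{u} R} {F N : Type u}
    [AddCommGroup F] [Module R F] [AddCommGroup N] [Module R N] [Module.Flat R F]
    (g : F →ₗ[R] N) (h : ExtGood.{w} X (LinearMap.range g)) :
    ExtGood.{w} X (LinearMap.ker g) ∧
      Function.Injective ((LinearMap.ker g).subtype.lTensor X) := by
  refine ExtGood.ker_aux (LinearMap.ker g).subtype g.rangeRestrict
    (Submodule.injective_subtype _) ?_ g.surjective_rangeRestrict h
  rw [LinearMap.exact_iff]
  simp

theorem lTensor_exact_of_range {X A B C : Type u} [AddCommGroup X] [Module R X]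
    [AddCommGroup A] [Module R A]
    [AddCommGroup B] [Module R B] [AddCommGroup C] [Module R C]
    (f : A →ₗ[R] B) (g : B →ₗ[R] C) (hfg : Function.Exact f g)
    (hi : Function.Injective ((LinearMap.range g).subtype.lTensor X)) :
    Function.Exact (f.lTensor X) (g.lTensor X) := by
  have h1 : Function.Exact f g.rangeRestrict := by
    rw [LinearMap.exact_iff, LinearMap.ker_rangeRestrict]
    exact LinearMap.exact_iff.1 hfg
  have h2 := lTensor_exact X h1 g.surjective_rangeRestrict
  have h3 : g.lTensor X = (LinearMap.range g).subtype.lTensor X ∘ₗ g.rangeRestrict.lTensor X := by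
    rw [← LinearMap.lTensor_comp]; rfl
  intro x
  rw [← h2 x, h3]
  exact map_eq_zero_iff _ hi

theorem tor_isZero [CategoryTheory.HasExt.{w} (ModuleCat.{u} R)]
    (X N : ModuleCat.{u} R) (h : ExtGood.{w} X N) (n : ℕ) :
    IsZero (((Tor (ModuleCat.{u} R) (n + 1)).obj X).obj N) := by
  let P := projectiveResolution N
  have hflat : ∀ n, Module.Flat R (P.complex.X n) := fun n => by
    have : Module.Projective R (P.complex.X n) :=
      (IsProjective.iff_projective _).2 (P.projective n)
    infer_instance
  have hex : ∀ n, Function.Exact (P.complex.d (n + 2) (n + 1)).hom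
      (P.complex.d (n + 1) n).hom := fun n =>
    (ShortComplex.ShortExact.moduleCat_exact_iff_function_exact _).mp (P.exact_succ n)
  have hex0 : Function.Exact (P.complex.d 1 0).hom (P.π.f 0).hom :=
    (ShortComplex.ShortExact.moduleCat_exact_iff_function_exact _).mp P.exact₀
  have hsurj : Function.Surjective (P.π.f 0).hom :=
    (ModuleCat.epi_iff_surjective _).1 inferInstance
  have hgood : ∀ n, ExtGood.{w} X (LinearMap.range (P.complex.d (n + 1) n).hom) ∧
      Function.Injective ((LinearMap.range (P.complex.d (n + 1) n).hom).subtype.lTensor X) := by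
    intro n
    induction n with
    | zero =>
      rw [← LinearMap.exact_iff.1 hex0]
      refine ExtGood.ker _ (ExtGood.of_equiv ?_ h)
      exact (LinearEquiv.ofTop _ (LinearMap.range_eq_top.2 hsurj)).symm
    | succ n ih =>
      rw [← LinearMap.exact_iff.1 (hex n)]
      exact ExtGood.ker _ ih.1
  have hfin := lTensor_exact_of_range (X := X) _ _ (hex n) (hgood n).2
  refine IsZero.of_iso ?_ (P.isoLeftDerivedObj
    ((MonoidalCategory.tensoringLeft (ModuleCat.{u} R)).obj X) (n + 1))
  refine (HomologicalComplex.exactAt_iff_isZero_homology _ _).1 ?_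
  rw [HomologicalComplex.exactAt_iff' _ (n + 2) (n + 1) n (by simp) (by simp)]
  exact (ShortComplex.ShortExact.moduleCat_exact_iff_function_exact _).mpr hfin

end aux

/-- The two `R`-module structures on the character module of an `S`-module agree. -/
def charEquiv (M : ModuleCat.{u} S) :
    (ModuleCat.restrictScalars φ).obj (ModuleCat.of S (CharacterModule M)) ≃ₗ[R]
      CharacterModule ((ModuleCat.restrictScalars φ).obj M) where
  toFun c := c
  invFun c := c
  left_inv _ := rfl
  right_inv _ := rfl
  map_add' _ _ := rfl
  map_smul' _ _ := rfl

theorem action_bijective (M : ModuleCat.{u} S)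
    (h : Function.Bijective (etaMap φ (ModuleCat.of S (CharacterModule M)))) :
    Function.Bijective (actionMap φ M) := by
  rw [← CharacterModule.dual_bijective_iff_bijective]
  let E := (LinearEquiv.congrRight (R := R) (M := SasR φ) (charEquiv φ M)).trans
    (CharacterModule.homEquiv (R := R))
  have : ⇑(CharacterModule.dual (actionMap φ M)) =
      E ∘ etaMap φ (ModuleCat.of S (CharacterModule M)) := by
    funext c
    apply (CharacterModule.homEquiv (R := R)).symm.injective
    refine LinearMap.ext fun x => CharacterModule.ext _ fun k => ?_
    rfl
  rw [this]
  exact E.bijective.comp h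

variable [CategoryTheory.HasExt.{w} (ModuleCat.{u} R)]

/-- If for every `S`-module `M` the canonical map `η_M : M → Hom_R(S,M)` is bijective and
`Ext^i_R(S,M) = 0` for `i ≥ 1`, then for every `S`-module `M` the action map
`α_M : S ⊗_R M → M` is bijective and `Tor_i^R(S,M) = 0` for `i ≥ 1`. -/
theorem action_bijective_and_tor_vanishing_of_eta_bijective_and_ext_vanishing
    (h : ∀ M : ModuleCat.{u} S, Function.Bijective (etaMap φ M) ∧
      ∀ i : ℕ, 1 ≤ i →
        Subsingleton (Abelian.Ext (SasR φ) ((ModuleCat.restrictScalars φ).obj M) i)) :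
    ∀ M : ModuleCat.{u} S, Function.Bijective (actionMap φ M) ∧
      ∀ i : ℕ, 1 ≤ i →
        IsZero (((Tor (ModuleCat.{u} R) i).obj (SasR φ)).obj
          ((ModuleCat.restrictScalars φ).obj M)) := by
  intro M
  refine ⟨action_bijective φ M (h _).1, fun i hi => ?_⟩
  obtain ⟨n, rfl⟩ : ∃ n, i = n + 1 := ⟨i - 1, by omega⟩
  refine tor_isZero.{w} _ _ (fun k => ?_) n
  exact extSubsingleton_of_iso (charEquiv φ M).toModuleIso (k + 1)
    ((h (ModuleCat.of S (CharacterModule M))).2 (k + 1) (by omega))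


end RingHomEpi
end
end

section
/- Let φ : R → S be a homomorphism of commutative rings. Then the multiplication map μ : S ⊗_R S → S, s ⊗ t ↦ st, is bijective and Tor_i^R(S, S) = 0 for all i ≥ 1 if and only if for every S-module M the canonical map η_M : M → Hom_R(S, M), m ↦ (s ↦ s • m), is bijective and Ext^i_R(S, M) = 0 for all i ≥ 1. -/
/-!
Homological epimorphisms of rings (Geigle–Lenzing).
`φ : R →+* S`; every `S`-module is an `R`-module by restriction of scalars.
-/

universe w u

open CategoryTheory Limits DerivedCategory

noncomputable section

namespace RingHomEpi

variable {R S : Type u} [CommRing R] [CommRing S] (φ : R →+* S)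

section helpers

open MonoidalCategory

section abstract_part

variable {C : Type*} [Category C] {D : Type*} [Category D] [Abelian C] [Abelian D]

/-- extension property of a complex -/
lemma contract_exists (Q : ChainComplex D ℕ) (hQ : ∀ n, Projective (Q.X n))
    (hex : ∀ n, (ShortComplex.mk _ _ (Q.d_comp_d (n + 2) (n + 1) n)).Exact)
    {Z : D} [Projective Z] (p : Q.X 0 ⟶ Z) (hpe : Epi p) (hp : Q.d 1 0 ≫ p = 0)
    (hp' : (ShortComplex.mk _ _ hp).Exact) (n : ℕ) :
    ∃ h : Q.X n ⟶ Q.X (n + 1), Q.d (n + 1) n ≫ h ≫ Q.d (n + 1) n = Q.d (n + 1) n := by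
  induction n with
  | zero =>
    have e : (𝟙 _ - p ≫ Projective.factorThru (𝟙 Z) p) ≫ p = 0 := by
      simp
    refine ⟨hp'.liftFromProjective _ e, ?_⟩
    have := hp'.liftFromProjective_comp _ e
    dsimp at this ⊢
    rw [this]
    simp [reassoc_of% hp]
  | succ n ih =>
    obtain ⟨h, hh⟩ := ih
    have e : (𝟙 _ - Q.d (n + 1) n ≫ h) ≫ Q.d (n + 1) n = 0 := by
      simp [hh]
    refine ⟨(hex n).liftFromProjective _ e, ?_⟩
    have := (hex n).liftFromProjective_comp _ e
    dsimp at this ⊢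
    rw [this]
    simp

lemma ext_of_contract (Q : ChainComplex D ℕ) (hQ : ∀ n, Projective (Q.X n))
    (n : ℕ)
    (hex : (ShortComplex.mk _ _ (Q.d_comp_d (n + 2) (n + 1) n)).Exact)
    (h : Q.X n ⟶ Q.X (n + 1)) (hh : Q.d (n + 1) n ≫ h ≫ Q.d (n + 1) n = Q.d (n + 1) n)
    {M : D} (f : Q.X (n + 1) ⟶ M) (hf : Q.d (n + 2) (n + 1) ≫ f = 0) :
    ∃ g : Q.X n ⟶ M, Q.d (n + 1) n ≫ g = f := by
  refine ⟨h ≫ f, ?_⟩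
  have e : (Q.d (n + 1) n ≫ h - 𝟙 _) ≫ Q.d (n + 1) n = 0 := by simp [hh]
  have := hex.liftFromProjective_comp _ e
  have h2 : (Q.d (n + 1) n ≫ h - 𝟙 _) ≫ f = 0 := by
    rw [← this]
    simp [hf]
  simpa [sub_eq_zero] using h2

lemma exact_of_ext (Q : ChainComplex D ℕ) (n : ℕ)
    (H : ∀ (M : D) (f : Q.X (n + 1) ⟶ M) (_ : Q.d (n + 2) (n + 1) ≫ f = 0),
      ∃ g : Q.X n ⟶ M, Q.d (n + 1) n ≫ g = f) :
    (ShortComplex.mk _ _ (Q.d_comp_d (n + 2) (n + 1) n)).Exact := by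
  obtain ⟨g, hg⟩ := H _ (cokernel.π (Q.d (n + 2) (n + 1))) (cokernel.condition _)
  rw [ShortComplex.exact_iff_kernel_ι_comp_cokernel_π_zero]
  change kernel.ι (Q.d (n + 1) n) ≫ cokernel.π (Q.d (n + 2) (n + 1)) = 0
  rw [← hg, kernel.condition_assoc, zero_comp]

lemma ext_iff [HasExt.{w} C] {F : C ⥤ D} {G : D ⥤ C} (adj : F ⊣ G) [F.Additive] {X : C}
    (P : ProjectiveResolution X) (M : D) (n : ℕ) :
    Subsingleton (Abelian.Ext X (G.obj M) (n + 1)) ↔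
    ∀ (f : F.obj (P.complex.X (n + 1)) ⟶ M) (_ : F.map (P.complex.d (n + 2) (n + 1)) ≫ f = 0),
      ∃ g : F.obj (P.complex.X n) ⟶ M, F.map (P.complex.d (n + 1) n) ≫ g = f := by
  constructor
  · intro H f hf
    have hf' : P.complex.d (n + 2) (n + 1) ≫ adj.homEquiv _ _ f = 0 := by
      rw [← adj.homEquiv_naturality_left, hf]
      have := adj.right_adjoint_additive
      simp [adj.homEquiv_unit]
    obtain ⟨g, hg⟩ := (P.extMk_eq_zero_iff _ (n + 2) rfl hf' n rfl).1 (Subsingleton.elim _ _)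
    refine ⟨(adj.homEquiv _ _).symm g, ?_⟩
    rw [← adj.homEquiv_naturality_left_symm, hg, Equiv.symm_apply_apply]
  · intro H
    refine subsingleton_of_forall_eq 0 fun α => ?_
    obtain ⟨f, hf, rfl⟩ := P.extMk_surjective α (n + 2) rfl
    rw [P.extMk_eq_zero_iff _ _ _ _ n rfl]
    obtain ⟨g, hg⟩ := H ((adj.homEquiv _ _).symm f) (by
      rw [← adj.homEquiv_naturality_left_symm, hf]
      simp [adj.homEquiv_counit])
    refine ⟨adj.homEquiv _ _ g, ?_⟩
    rw [← adj.homEquiv_naturality_left, hg, Equiv.apply_symm_apply]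

lemma derived_iff (T : C ⥤ D) [T.Additive] [HasProjectiveResolutions C] {X : C}
    (P : ProjectiveResolution X) (n : ℕ) :
    IsZero ((T.leftDerived (n + 1)).obj X) ↔
      ((ShortComplex.mk _ _ (P.complex.d_comp_d (n + 2) (n + 1) n)).map T).Exact := by
  rw [(P.isoLeftDerivedObj T (n + 1)).isZero_iff]
  change IsZero (HomologicalComplex.homology _ _) ↔ _
  rw [← HomologicalComplex.exactAt_iff_isZero_homology,
    HomologicalComplex.exactAt_iff' _ (n + 2) (n + 1) n (by simp) (by simp)]
  rfl

end abstract_part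

instance ext_additive : (ModuleCat.extendScalars.{u, u, u} φ).Additive :=
  (ModuleCat.extendRestrictScalarsAdj φ).left_adjoint_additive

lemma map_exact_iff (X : ShortComplex (ModuleCat.{u} R)) :
    (X.map ((tensoringLeft (ModuleCat.{u} R)).obj (SasR φ))).Exact ↔
      (X.map (ModuleCat.extendScalars.{u, u, u} φ)).Exact := by
  rw [ShortComplex.moduleCat_exact_iff, ShortComplex.moduleCat_exact_iff]
  exact Iff.rfl

/-- pure tensors -/
abbrev tm (s t : SasR φ) : TensorProduct R (SasR φ) (SasR φ) := TensorProduct.tmul R s t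

lemma eta_bij_of_mul (h : Function.Injective (mulMap φ)) (M : ModuleCat.{u} S) :
    Function.Bijective (etaMap φ M) := by
  constructor
  · intro m m' hm
    have := LinearMap.congr_fun hm (1 : S)
    change (1 : S) • m = (1 : S) • m' at this
    simpa using this
  · intro f
    refine ⟨f (1 : S), ?_⟩
    apply LinearMap.ext
    intro s
    have e : tm φ s (1 : S) =
        tm φ (1 : S) s := by
      apply h
      change (show S from s) * 1 = 1 * (show S from s)
      exact (mul_one _).trans (one_mul _).symm
    have e2 := congrArg (fun x => actionMap φ M (LinearMap.lTensor (SasR φ) f x)) e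
    change (show S from s) • (show M from f (1 : S)) = (1 : S) • (show M from f s) at e2
    rw [one_smul] at e2
    exact e2

lemma mul_bij_of_eta (h : ∀ M : ModuleCat.{u} S, Function.Bijective (etaMap φ M)) :
    Function.Bijective (mulMap φ) := by
  let M := (ModuleCat.extendScalars.{u, u, u} φ).obj (SasR φ)
  let f := ((ModuleCat.extendRestrictScalarsAdj φ).unit.app (SasR φ)).hom
  obtain ⟨m, hm⟩ := (h M).2 f
  have key : ∀ s : S, s • m = (tm φ (1 : S) s : M) :=
    fun s => LinearMap.congr_fun hm s
  have key1 : m = (tm φ (1 : S) (1 : S) : M) := by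
    rw [← key, one_smul]
  have key2 : ∀ s : S, tm φ (1 : S) s =
      tm φ s (1 : S) := by
    intro s
    have := key s
    rw [key1] at this
    refine this.symm.trans ?_
    exact (ModuleCat.ExtendScalars.smul_tmul φ s 1 (M := SasR φ) (1 : S)).trans (congrArg (fun z : S => tm φ z (1 : S)) (mul_one s))
  have key3 : ∀ x : TensorProduct R (SasR φ) (SasR φ),
      x = tm φ (mulMap φ x) (1 : S) := by
    intro x
    induction x using TensorProduct.induction_on with
    | zero =>
      rw [map_zero]
      exact (TensorProduct.zero_tmul _ _).symm
    | add x y hx hy =>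
      rw [map_add]
      exact (congrArg₂ (· + ·) hx hy).trans (TensorProduct.add_tmul _ _ _).symm
    | tmul s t =>
      have := congrArg (fun z : M => (show S from s) • z) (key2 t)
      have h1 := ModuleCat.ExtendScalars.smul_tmul φ s 1 (M := SasR φ) t
      have h2 := ModuleCat.ExtendScalars.smul_tmul φ s t (M := SasR φ) (1 : S)
      have h3 := congrArg (fun z : S => tm φ z t) (mul_one (show S from s))
      exact (h1.trans h3).symm.trans (this.trans h2)
  constructor
  · intro x y hxy
    rw [key3 x, key3 y, hxy]
  · intro s
    refine ⟨tm φ s (1 : S), ?_⟩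
    change (show S from s) * 1 = s
    exact mul_one _

lemma projective_ext (h : Function.Bijective (mulMap φ)) :
    Projective ((ModuleCat.extendScalars.{u, u, u} φ).obj (SasR φ)) := by
  let c := (ModuleCat.extendRestrictScalarsAdj φ).counit.app (ModuleCat.of S S)
  have hc : Function.Bijective c := by
    have : ∀ x, c x = mulMap φ x := by
      intro x
      induction x using TensorProduct.induction_on with
      | zero => exact (map_zero c.hom).trans (map_zero (mulMap φ)).symm
      | add x y hx hy =>
        exact (map_add c.hom x y).trans
          ((congrArg₂ (· + ·) hx hy).trans (map_add (mulMap φ) x y).symm)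
      | tmul s t => rfl
    have e : (c : _ → _) = mulMap φ := funext this
    rw [e]; exact h
  have : IsIso c := (ConcreteCategory.isIso_iff_bijective c).2 hc
  have : Projective (ModuleCat.of S S) := inferInstance
  exact Projective.of_iso (asIso c).symm this

end helpers

variable [CategoryTheory.HasExt.{w} (ModuleCat.{u} R)]

/-- For a homomorphism `φ : R →+* S` of commutative rings, the multiplication map
`μ : S ⊗_R S → S` is bijective and `Tor_i^R(S,S) = 0` for all `i ≥ 1` if and only if for
every `S`-module `M` the canonical map `η_M : M → Hom_R(S,M)`, `m ↦ (s ↦ s • m)`, is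
bijective and `Ext^i_R(S,M) = 0` for all `i ≥ 1`. -/
theorem mul_bijective_and_tor_vanishing_iff_eta_bijective_and_ext_vanishing :
    (Function.Bijective (mulMap φ) ∧
      ∀ i : ℕ, 1 ≤ i →
        IsZero (((Tor (ModuleCat.{u} R) i).obj (SasR φ)).obj (SasR φ))) ↔
    (∀ M : ModuleCat.{u} S, Function.Bijective (etaMap φ M) ∧
      ∀ i : ℕ, 1 ≤ i →
        Subsingleton (Abelian.Ext (SasR φ) ((ModuleCat.restrictScalars φ).obj M) i)) := by

  let P := projectiveResolution (SasR φ)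
  let F := ModuleCat.extendScalars.{u, u, u} φ
  let adj : F ⊣ ModuleCat.restrictScalars.{u} φ := ModuleCat.extendRestrictScalarsAdj φ
  let Q : ChainComplex (ModuleCat.{u} S) ℕ := (F.mapHomologicalComplex _).obj P.complex
  have tor : ∀ n, IsZero (((Tor (ModuleCat.{u} R) (n + 1)).obj (SasR φ)).obj (SasR φ)) ↔
      (ShortComplex.mk _ _ (Q.d_comp_d (n + 2) (n + 1) n)).Exact := fun n =>
    (derived_iff _ P n).trans (map_exact_iff φ _)
  have hQ : ∀ n, Projective (Q.X n) := fun n => adj.map_projective _ (P.projective n)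
  constructor
  · rintro ⟨hmul, htor⟩ M
    refine ⟨eta_bij_of_mul φ hmul.1 M, ?_⟩
    have hex := fun n => (tor n).1 (htor (n + 1) (by omega))
    have : Projective (F.obj (((ChainComplex.single₀ (ModuleCat.{u} R)).obj (SasR φ)).X 0)) :=
      projective_ext φ hmul
    have hl : F.IsLeftAdjoint := adj.isLeftAdjoint
    have hepi : Epi (P.π.f 0) := inferInstance
    have hp' := P.exact₀.map_of_epi_of_preservesCokernel F hepi inferInstance
    have hcon := fun n => contract_exists Q hQ hex (F.map (P.π.f 0)) (F.map_epi _)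
      (by exact (F.map_comp _ _).symm.trans ((congrArg F.map P.complex_d_comp_π_f_zero).trans
        (F.map_zero _ _))) hp' n
    intro i hi
    obtain ⟨n, rfl⟩ : ∃ n, i = n + 1 := ⟨i - 1, by omega⟩
    rw [ext_iff adj P]
    intro f hf
    obtain ⟨h, hh⟩ := hcon n
    exact ext_of_contract Q hQ n (hex n) h hh f hf
  · intro H
    refine ⟨mul_bij_of_eta φ fun M => (H M).1, ?_⟩
    intro i hi
    obtain ⟨n, rfl⟩ : ∃ n, i = n + 1 := ⟨i - 1, by omega⟩
    rw [tor]
    exact exact_of_ext Q n fun M => (ext_iff adj P M n).1 ((H M).2 (n + 1) hi)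

end RingHomEpi
end
end
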